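/- arXiv:2202.11474 — 2 statements merged into one kernel-verified Lean document; each statement's English description precedes it below -/
import Mathlib

section
/- Let X be a real random variable and let 0 < R₁ ≤ R₂ be constants such that exp(R₁ t²) ≤ E[exp(t X)] ≤ exp(R₂ t²) for all t ≥ 0. Then for every x ∈ ℝ, P(X ≥ x) ≥ C₁ · exp(−C₂ x²), where C₁ := (1 − e^{−1})² · exp(4 − 8R₂/R₁) and C₂ := (4R₂ − 2R₁)/R₁². -/
open MeasureTheory Real

/-- A Paley–Zygmund type bound: if `Z ≤ c` off `A`, `E[Z] ≥ c + d` and `E[Z²] ≤ S`,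
then `d² / S ≤ P(A)`. -/
theorem sq_div_le_measureReal_of_le_off {Ω : Type*} {mΩ : MeasurableSpace Ω} (μ : Measure Ω)
    [IsProbabilityMeasure μ] {Z : Ω → ℝ} {A : Set Ω} (hA : MeasurableSet A) {c d S : ℝ}
    (hc : 0 ≤ c) (hd : 0 < d) (hS : 0 < S) (hZ : Integrable Z μ)
    (hZ2 : Integrable (fun ω => Z ω ^ 2) μ) (hoff : ∀ ω ∉ A, Z ω ≤ c)
    (hmean : c + d ≤ ∫ ω, Z ω ∂μ) (hsq : ∫ ω, Z ω ^ 2 ∂μ ≤ S) :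
    d ^ 2 / S ≤ μ.real A := by
  set l : ℝ := S / d with hl
  have hl0 : 0 < l := div_pos hS hd
  have hind : Integrable (A.indicator fun _ => l ^ 2) μ := (integrable_const _).indicator hA
  have hpt : ∀ ω, 2 * l * Z ω ≤ 2 * l * c + (Z ω ^ 2 + A.indicator (fun _ => l ^ 2) ω) := by
    intro ω
    by_cases h : ω ∈ A
    · rw [Set.indicator_of_mem h]
      nlinarith [sq_nonneg (Z ω - l), mul_nonneg hl0.le hc]
    · rw [Set.indicator_of_notMem h]
      nlinarith [mul_le_mul_of_nonneg_left (hoff ω h) hl0.le, sq_nonneg (Z ω)]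
  have hsum : Integrable (fun ω => Z ω ^ 2 + A.indicator (fun _ => l ^ 2) ω) μ := hZ2.add hind
  have hmono := integral_mono (hZ.const_mul (2 * l))
    ((integrable_const (2 * l * c)).add hsum) hpt
  simp only [Pi.add_apply] at hmono
  rw [integral_const_mul, integral_add (integrable_const _) hsum, integral_add hZ2 hind,
    integral_indicator_const _ hA] at hmono
  simp only [integral_const, probReal_univ, smul_eq_mul, one_mul] at hmono
  have hm := mul_le_mul_of_nonneg_left hmean (by positivity : 0 ≤ 2 * l)
  have hld : l * d = S := by rw [hl]; field_simp
  have key : S ≤ μ.real A * l ^ 2 := by nlinarith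
  have hld2 : l ^ 2 * (d ^ 2 / S) = S := by rw [hl]; field_simp
  have hl2 : 0 < l ^ 2 := by positivity
  nlinarith

/-- If `exp (R₁ t²) ≤ E[exp (t X)] ≤ exp (R₂ t²)` for all `t ≥ 0`, with `0 < R₁ ≤ R₂`,
then `P(X ≥ x) ≥ C₁ exp (-C₂ x²)` with `C₁ = (1 - e⁻¹)² exp (4 - 8 R₂ / R₁)` and
`C₂ = (4 R₂ - 2 R₁) / R₁²`. -/
theorem stmt_0 {Ω : Type*} {mΩ : MeasurableSpace Ω} (μ : Measure Ω) [IsProbabilityMeasure μ]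
    (X : Ω → ℝ) (hX : Measurable X) (R₁ R₂ : ℝ) (hR₁ : 0 < R₁) (hR₁₂ : R₁ ≤ R₂)
    (hint : ∀ t : ℝ, 0 ≤ t → Integrable (fun ω => Real.exp (t * X ω)) μ)
    (hlow : ∀ t : ℝ, 0 ≤ t → Real.exp (R₁ * t ^ 2) ≤ ∫ ω, Real.exp (t * X ω) ∂μ)
    (hup : ∀ t : ℝ, 0 ≤ t → ∫ ω, Real.exp (t * X ω) ∂μ ≤ Real.exp (R₂ * t ^ 2)) :
    ∀ x : ℝ,
      (1 - Real.exp (-1)) ^ 2 * Real.exp (4 - 8 * R₂ / R₁) *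
          Real.exp (-((4 * R₂ - 2 * R₁) / R₁ ^ 2) * x ^ 2)
        ≤ (μ {ω | x ≤ X ω}).toReal := by
  intro x
  set t : ℝ := √(x ^ 2 / R₁ ^ 2 + 2 / R₁) with ht
  have ht0 : 0 ≤ t := Real.sqrt_nonneg _
  have ht2 : t ^ 2 = x ^ 2 / R₁ ^ 2 + 2 / R₁ := Real.sq_sqrt (by positivity)
  have hRt : R₁ * t ^ 2 - 1 = x ^ 2 / R₁ + 1 := by rw [ht2]; field_simp; ring
  have htx : t * x ≤ R₁ * t ^ 2 - 1 := by
    rw [hRt]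
    refine le_of_abs_le (abs_le_of_sq_le_sq ?_ (by positivity))
    have : (t * x) ^ 2 = (x ^ 2 / R₁ + 1) ^ 2 - 1 := by
      rw [mul_pow, ht2]; field_simp; ring
    linarith
  have he : Real.exp (-1) < 1 := Real.exp_lt_one_iff.mpr (by norm_num)
  have hsq : (fun ω => Real.exp (t * X ω) ^ 2) = fun ω => Real.exp (2 * t * X ω) := by
    funext ω
    rw [← Real.exp_nat_mul]
    congr 1
    push_cast
    ring
  have hc : Real.exp (t * x) ≤ Real.exp (-1) * Real.exp (R₁ * t ^ 2) := by
    rw [← Real.exp_add]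
    exact Real.exp_le_exp.mpr (by linarith)
  have hpz := sq_div_le_measureReal_of_le_off μ (Z := fun ω => Real.exp (t * X ω))
    (A := {ω | x ≤ X ω}) (c := Real.exp (t * x))
    (d := (1 - Real.exp (-1)) * Real.exp (R₁ * t ^ 2)) (S := Real.exp (R₂ * (2 * t) ^ 2))
    (measurableSet_le measurable_const hX) (Real.exp_pos _).le
    (mul_pos (by linarith) (Real.exp_pos _)) (Real.exp_pos _) (hint t ht0)
    (by rw [hsq]; exact hint _ (by positivity))
    (fun ω h => Real.exp_le_exp.mpr (mul_le_mul_of_nonneg_left (not_le.mp h).le ht0))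
    (by linarith [hlow t ht0])
    (by rw [hsq]; exact hup _ (by positivity))
  refine le_trans (le_of_eq ?_) hpz
  rw [mul_pow, mul_div_assoc (_ ^ 2), mul_assoc, ← Real.exp_add, ← Real.exp_nat_mul, ← Real.exp_sub]
  congr 2
  rw [mul_pow, ht2]
  push_cast
  field_simp
  ring
end

section
/- Let X be a real random variable and let 0 < R₁ ≤ R₂ be constants such that exp(R₁ s²) ≤ E[exp(s X)] ≤ exp(R₂ s²) for all s ≥ 0. Then for every t > 0, P(X ≥ R₁ t − 1/t) ≥ (1 − e^{−1})² · exp(−(4R₂ − 2R₁) t²). -/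
open MeasureTheory Real

/-- If `exp (R₁ s²) ≤ E[exp (s X)] ≤ exp (R₂ s²)` for all `s ≥ 0`, with `0 < R₁ ≤ R₂`,
then for every `t > 0`, `P(X ≥ R₁ t - 1/t) ≥ (1 - e⁻¹)² exp (-(4 R₂ - 2 R₁) t²)`. -/
theorem stmt_1 {Ω : Type*} {mΩ : MeasurableSpace Ω} (μ : Measure Ω) [IsProbabilityMeasure μ]
    (X : Ω → ℝ) (hX : Measurable X) (R₁ R₂ : ℝ) (hR₁ : 0 < R₁) (hR₁₂ : R₁ ≤ R₂)
    (hint : ∀ s : ℝ, 0 ≤ s → Integrable (fun ω => Real.exp (s * X ω)) μ)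
    (hlow : ∀ s : ℝ, 0 ≤ s → Real.exp (R₁ * s ^ 2) ≤ ∫ ω, Real.exp (s * X ω) ∂μ)
    (hup : ∀ s : ℝ, 0 ≤ s → ∫ ω, Real.exp (s * X ω) ∂μ ≤ Real.exp (R₂ * s ^ 2)) :
    ∀ t : ℝ, 0 < t →
      (1 - Real.exp (-1)) ^ 2 * Real.exp (-(4 * R₂ - 2 * R₁) * t ^ 2)
        ≤ (μ {ω | R₁ * t - 1 / t ≤ X ω}).toReal := by
  intro t ht
  set A : Set Ω := {ω | R₁ * t - 1 / t ≤ X ω} with hA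
  have hAm : MeasurableSet A := measurableSet_le measurable_const hX
  have hint₁ := hint t ht.le
  have hint₂ := hint (2 * t) (by positivity)
  have hlow₁ := hlow t ht.le
  have hup₂ := hup (2 * t) (by positivity)
  have hindicator : Integrable (A.indicator fun _ => (1 : ℝ)) μ :=
    (integrable_const 1).indicator hAm
  have hexp : Real.exp (-1) < 1 := by simp
  have hcut : Real.exp (t * (R₁ * t - 1 / t)) = Real.exp (-1) * Real.exp (R₁ * t ^ 2) := by
    rw [← Real.exp_add]
    congr 1
    field_simp
    ring
  set m : ℝ := (1 - Real.exp (-1)) * Real.exp (R₁ * t ^ 2) with hm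
  set B : ℝ := Real.exp (R₂ * (2 * t) ^ 2) with hB
  have hm_pos : 0 < m := mul_pos (sub_pos.2 hexp) (Real.exp_pos _)
  have hB_pos : 0 < B := Real.exp_pos _
  have key : ∀ c : ℝ, 0 ≤ c → 2 * c * m ≤ B + c ^ 2 * μ.real A := by
    intro c hc
    have hpt : ∀ ω, 2 * c * Real.exp (t * X ω) ≤
        2 * c * Real.exp (t * (R₁ * t - 1 / t)) + Real.exp (2 * t * X ω)
          + c ^ 2 * A.indicator (fun _ => (1 : ℝ)) ω := by
      intro ω
      have hsq : Real.exp (2 * t * X ω) = Real.exp (t * X ω) ^ 2 := by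
        rw [← Real.exp_nat_mul]
        congr 1
        push_cast
        ring
      rw [hsq]
      by_cases hω : ω ∈ A
      · rw [Set.indicator_of_mem hω]
        have := mul_nonneg hc (Real.exp_pos (t * (R₁ * t - 1 / t))).le
        nlinarith [sq_nonneg (Real.exp (t * X ω) - c)]
      · rw [Set.indicator_of_notMem hω]
        have hlt : X ω < R₁ * t - 1 / t := not_le.1 hω
        have hle : Real.exp (t * X ω) ≤ Real.exp (t * (R₁ * t - 1 / t)) :=
          Real.exp_le_exp.2 (mul_le_mul_of_nonneg_left hlt.le ht.le)
        nlinarith [mul_le_mul_of_nonneg_left hle hc, sq_nonneg (Real.exp (t * X ω))]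
    have hmono := integral_mono (hint₁.const_mul (2 * c))
      (((integrable_const (2 * c * Real.exp (t * (R₁ * t - 1 / t)))).add hint₂).add
        (hindicator.const_mul (c ^ 2))) hpt
    rw [integral_add' ((integrable_const _).add hint₂) (hindicator.const_mul _),
      integral_add' (integrable_const _) hint₂, integral_const_mul,
      integral_const_mul (c ^ 2), integral_indicator_const _ hAm, integral_const, hcut] at hmono
    simp only [probReal_univ, smul_eq_mul, one_mul, mul_one] at hmono
    have := mul_le_mul_of_nonneg_left hlow₁ hc
    rw [hm]
    linarith
  have hbound := key (B / m) (by positivity)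
  have hratio : (1 - Real.exp (-1)) ^ 2 * Real.exp (-(4 * R₂ - 2 * R₁) * t ^ 2) = m ^ 2 / B := by
    rw [eq_div_iff hB_pos.ne', hm, hB, mul_assoc, ← Real.exp_add, mul_pow _ (Real.exp _), ← Real.exp_nat_mul]
    congr 2
    push_cast
    ring
  rw [hratio, div_le_iff₀ hB_pos]
  change m ^ 2 ≤ μ.real A * B
  field_simp at hbound
  nlinarith
end
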